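/- No fragment F of intuitionistic propositional logic containing both ∨ and ¬ has a finite semantics. That is, if {∨, ¬} ⊆ F, there is no algebra with finite universe V carrying an operation for each connective in F, together with a subset D ⊆ V, such that for all Γ ∪ {φ} ⊆ 𝔉_F one has Γ ⊢_F φ iff Γ ⊨_{A,D} φ. -/

import Mathlib

/-- The four propositional connectives. -/
inductive Conn : Type
  | conj | disj | impl | nega
deriving DecidableEq

/-- Propositional formulas over countably many letters `p₀, p₁, …`. -/
inductive PropForm : Type
  | var : ℕ → PropForm
  | and : PropForm → PropForm → PropForm
  | or : PropForm → PropForm → PropForm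
  | imp : PropForm → PropForm → PropForm
  | neg : PropForm → PropForm

/-- The set of connectives occurring in a formula. -/
def PropForm.conns : PropForm → Set Conn
  | .var _ => ∅
  | .and a b => insert .conj (a.conns ∪ b.conns)
  | .or a b => insert .disj (a.conns ∪ b.conns)
  | .imp a b => insert .impl (a.conns ∪ b.conns)
  | .neg a => insert .nega a.conns

/-- `φ ∈ 𝔉_F` : the formula `φ` uses only connectives belonging to the fragment `F`. -/
def InFrag (F : Set Conn) (φ : PropForm) : Prop := φ.conns ⊆ F

/-- Derivability `Γ ⊢_F φ` for the fragment `F`: the least relation closed under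
membership, monotonicity, cut, and the two directions of the rules
(R∧), (R∨), (R→), (R¬I), (R¬E) for the connectives in `F`. -/
inductive Deriv (F : Set Conn) : Set PropForm → PropForm → Prop
  | mem {Γ : Set PropForm} {φ : PropForm} : φ ∈ Γ → Deriv F Γ φ
  | mono {Γ : Set PropForm} {φ ψ : PropForm} : Deriv F Γ φ → Deriv F (insert ψ Γ) φ
  | cut {Γ Δ : Set PropForm} {φ ψ : PropForm} :
      Deriv F Γ φ → Deriv F (insert φ Δ) ψ → Deriv F (Γ ∪ Δ) ψ
  | andI {Γ : Set PropForm} {φ ψ : PropForm} :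
      Conn.conj ∈ F → Deriv F Γ φ → Deriv F Γ ψ → Deriv F Γ (.and φ ψ)
  | andE1 {Γ : Set PropForm} {φ ψ : PropForm} :
      Conn.conj ∈ F → Deriv F Γ (.and φ ψ) → Deriv F Γ φ
  | andE2 {Γ : Set PropForm} {φ ψ : PropForm} :
      Conn.conj ∈ F → Deriv F Γ (.and φ ψ) → Deriv F Γ ψ
  | orI {Γ : Set PropForm} {φ ψ χ : PropForm} :
      Conn.disj ∈ F → Deriv F (insert φ Γ) χ → Deriv F (insert ψ Γ) χ →
      Deriv F (insert (.or φ ψ) Γ) χ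
  | orE1 {Γ : Set PropForm} {φ ψ χ : PropForm} :
      Conn.disj ∈ F → Deriv F (insert (.or φ ψ) Γ) χ → Deriv F (insert φ Γ) χ
  | orE2 {Γ : Set PropForm} {φ ψ χ : PropForm} :
      Conn.disj ∈ F → Deriv F (insert (.or φ ψ) Γ) χ → Deriv F (insert ψ Γ) χ
  | impI {Γ : Set PropForm} {φ ψ : PropForm} :
      Conn.impl ∈ F → Deriv F (insert φ Γ) ψ → Deriv F Γ (.imp φ ψ)
  | impE {Γ : Set PropForm} {φ ψ : PropForm} :
      Conn.impl ∈ F → Deriv F Γ (.imp φ ψ) → Deriv F (insert φ Γ) ψ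
  | negI {Γ : Set PropForm} {φ ψ : PropForm} :
      Conn.nega ∈ F → Deriv F (insert φ Γ) ψ → Deriv F (insert φ Γ) (.neg ψ) →
      Deriv F Γ (.neg φ)
  | negE {Γ : Set PropForm} {φ ψ : PropForm} :
      Conn.nega ∈ F → Deriv F Γ φ → Deriv F Γ (.neg φ) → Deriv F Γ ψ

/-- An algebra interpreting the connectives on a carrier `V`. -/
structure Alg (V : Type) where
  and : V → V → V
  or : V → V → V
  imp : V → V → V
  neg : V → V

/-- The homomorphic extension of an assignment `v` of letters. -/
def Alg.eval {V : Type} (A : Alg V) (v : ℕ → V) : PropForm → V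
  | .var n => v n
  | .and a b => A.and (A.eval v a) (A.eval v b)
  | .or a b => A.or (A.eval v a) (A.eval v b)
  | .imp a b => A.imp (A.eval v a) (A.eval v b)
  | .neg a => A.neg (A.eval v a)

/-- Semantic consequence `Γ ⊨_{A,D} φ`. -/
def SemConseq {V : Type} (A : Alg V) (D : Set V) (Γ : Set PropForm) (φ : PropForm) : Prop :=
  ∀ v : ℕ → V, (∀ ψ ∈ Γ, A.eval v ψ ∈ D) → A.eval v φ ∈ D

/-- The fragment `F` has a finite semantics. -/
def HasFiniteSemantics (F : Set Conn) : Prop :=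
  ∃ (V : Type) (_ : Fintype V) (A : Alg V) (D : Set V),
    ∀ (Γ : Set PropForm) (φ : PropForm),
      (∀ ψ ∈ Γ, InFrag F ψ) → InFrag F φ →
      (Deriv F Γ φ ↔ SemConseq A D Γ φ)

/-- `φ ∨̇ ψ = (φ → ψ) → ψ`. -/
def dvee (a b : PropForm) : PropForm := .imp (.imp a b) b

/-- Left-associated iterated `∨̇` of a list of formulas. -/
def bigDvee : List PropForm → PropForm
  | [] => .var 0
  | a :: rest => rest.foldl dvee a

/-- Left-associated iterated `∨` of a list of formulas. -/
def bigOrF : List PropForm → PropForm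
  | [] => .var 0
  | a :: rest => rest.foldl PropForm.or a

/-- All pairs `(i, j)` with `1 ≤ i < j ≤ n+1`. -/
def pairs (n : ℕ) : List (ℕ × ℕ) :=
  (List.range' 2 n).flatMap fun j => (List.range' 1 (j - 1)).map fun i => (i, j)

/-- `α_n = ∨̇_{1 ≤ i < j ≤ n+1} (p_j → p_i)`. -/
def alphaImp (n : ℕ) : PropForm :=
  bigDvee ((pairs n).map fun p => .imp (.var p.2) (.var p.1))

/-- `α_n = ⋁_{1 ≤ i < j ≤ n+1} ¬¬(¬p_i ∨ p_j)`. -/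
def alphaOrNeg (n : ℕ) : PropForm :=
  bigOrF ((pairs n).map fun p => .neg (.neg (.or (.neg (.var p.1)) (.var p.2))))

/-- Two-valued Boolean evaluation. -/
def evalBool (v : ℕ → Bool) : PropForm → Bool
  | .var n => v n
  | .and a b => evalBool v a && evalBool v b
  | .or a b => evalBool v a || evalBool v b
  | .imp a b => !evalBool v a || evalBool v b
  | .neg a => !evalBool v a

/-- Classical (two-valued) consequence `Γ ⊢_c φ`. -/
def ClassConseq (Γ : Set PropForm) (φ : PropForm) : Prop :=
  ∀ v : ℕ → Bool, (∀ ψ ∈ Γ, evalBool v ψ = true) → evalBool v φ = true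

/-- The two-element Boolean algebra `𝟐`. -/
def alg2 : Alg Bool where
  and a b := a && b
  or a b := a || b
  imp a b := !a || b
  neg a := !a

/-- The three-element algebra `𝟑` on the chain `0 < 1/2 < 1` (coded as `0 < 1 < 2` in `Fin 3`),
with meet `min` and meet complement `¬0 = 1`, `¬(1/2) = ¬1 = 0` (its `or`/`imp` are those of the
3-element Heyting chain). -/
def alg3 : Alg (Fin 3) where
  and a b := min a b
  or a b := max a b
  imp a b := if a ≤ b then 2 else b
  neg a := if a = 0 then 2 else 0

/-- The `(n+1)`-element Heyting chain, coded on `Fin (n+1)` (so `k` codes the element `k+1`). -/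
def chainAlg (n : ℕ) : Alg (Fin (n + 1)) where
  and a b := min a b
  or a b := max a b
  imp a b := if a ≤ b then Fin.last n else b
  neg a := if a = 0 then Fin.last n else 0

/-- Truth at the `k`-th leaf of the infinite fork, where the letter `i` holds iff `i ≤ k`. -/
def LeafForces (k : ℕ) : PropForm → Prop
  | .var i => i ≤ k
  | .and a b => LeafForces k a ∧ LeafForces k b
  | .or a b => LeafForces k a ∨ LeafForces k b
  | .imp a b => LeafForces k a → LeafForces k b
  | .neg a => ¬ LeafForces k a

/-- Kripke forcing at the root of the infinite fork, where no letter holds. -/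
def RootForces : PropForm → Prop
  | .var _ => False
  | .and a b => RootForces a ∧ RootForces b
  | .or a b => RootForces a ∨ RootForces b
  | .imp a b => (RootForces a → RootForces b) ∧ ∀ k, LeafForces k a → LeafForces k b
  | .neg a => ∀ k, ¬ LeafForces k a

theorem RootForces.leafForces {φ : PropForm} (h : RootForces φ) (k : ℕ) : LeafForces k φ := by
  induction φ with
  | var => exact h.elim
  | and a b iha ihb => exact ⟨iha h.1, ihb h.2⟩
  | or a b iha ihb => exact h.imp iha ihb
  | imp a b => exact h.2 k
  | neg a => exact h k

theorem Deriv.leafForces {F : Set Conn} {Γ : Set PropForm} {φ : PropForm} (h : Deriv F Γ φ)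
    (k : ℕ) (hΓ : ∀ ψ ∈ Γ, LeafForces k ψ) : LeafForces k φ := by
  induction h with
  | mem h => exact hΓ _ h
  | _ =>
    simp only [Set.forall_mem_insert, Set.mem_union, or_imp, forall_and, LeafForces] at *
    tauto

theorem Deriv.rootForces {F : Set Conn} {Γ : Set PropForm} {φ : PropForm} (h : Deriv F Γ φ)
    (hΓ : ∀ ψ ∈ Γ, RootForces ψ) : RootForces φ := by
  induction h with
  | mem h => exact hΓ _ h
  | impI _ h ih =>
    refine ⟨fun ha => ih (Set.forall_mem_insert.2 ⟨ha, hΓ⟩), fun k ha => ?_⟩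
    exact h.leafForces k (Set.forall_mem_insert.2 ⟨ha, fun ψ hψ => (hΓ ψ hψ).leafForces k⟩)
  | negI _ h₁ h₂ =>
    intro k ha
    have hk := Set.forall_mem_insert.2 ⟨ha, fun ψ hψ => (hΓ ψ hψ).leafForces k⟩
    exact h₂.leafForces k hk (h₁.leafForces k hk)
  | negE _ _ _ ih₁ ih₂ => exact absurd ((ih₁ hΓ).leafForces 0) (ih₂ hΓ 0)
  | _ =>
    simp only [Set.forall_mem_insert, Set.mem_union, or_imp, forall_and, RootForces] at *
    tauto

theorem rootForces_foldl_or {l : List PropForm} {b : PropForm}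
    (h : RootForces (l.foldl .or b)) : RootForces b ∨ ∃ a ∈ l, RootForces a := by
  induction l generalizing b with
  | nil => exact .inl h
  | cons a l ih =>
    rcases ih h with (h | h) | ⟨c, hc, h⟩
    · exact .inl h
    · exact .inr ⟨a, by simp, h⟩
    · exact .inr ⟨c, by simp [hc], h⟩

theorem exists_rootForces_of_bigOrF {l : List PropForm} (h : RootForces (bigOrF l)) :
    ∃ a ∈ l, RootForces a := by
  cases l with
  | nil => exact h.elim
  | cons a l => simpa using rootForces_foldl_or h

theorem deriv_foldl_or {F : Set Conn} (hd : Conn.disj ∈ F) (l : List PropForm) (b : PropForm) :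
    Deriv F {b} (l.foldl .or b) ∧ ∀ a ∈ l, Deriv F {a} (l.foldl .or b) := by
  induction l generalizing b with
  | nil => exact ⟨.mem rfl, by simp⟩
  | cons a l ih =>
    obtain ⟨h, hl⟩ := ih (.or b a)
    rw [← insert_empty_eq] at h
    have hb := Deriv.orE1 hd h
    have ha := Deriv.orE2 hd h
    rw [insert_empty_eq] at hb ha
    exact ⟨hb, List.forall_mem_cons.2 ⟨ha, hl⟩⟩

theorem deriv_bigOrF_of_mem {F : Set Conn} (hd : Conn.disj ∈ F) {l : List PropForm}
    {a : PropForm} (ha : a ∈ l) : Deriv F {a} (bigOrF l) := by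
  cases l with
  | nil => simp at ha
  | cons b l =>
    obtain ⟨hb, hl⟩ := deriv_foldl_or hd l b
    exact (List.forall_mem_cons.2 ⟨hb, hl⟩ : ∀ a ∈ b :: l, Deriv F {a} (l.foldl .or b)) a ha

theorem inFrag_bigOrF {F : Set Conn} (hd : Conn.disj ∈ F) {l : List PropForm}
    (hl : ∀ a ∈ l, InFrag F a) : InFrag F (bigOrF l) := by
  have foldl_or (l : List PropForm) (b : PropForm) (hb : InFrag F b)
      (hl : ∀ a ∈ l, InFrag F a) : InFrag F (l.foldl .or b) := by
    induction l generalizing b with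
    | nil => exact hb
    | cons a l ih =>
      rw [List.forall_mem_cons] at hl
      exact ih _ (Set.insert_subset hd (Set.union_subset hb hl.1)) hl.2
  cases l with
  | nil => exact Set.empty_subset F
  | cons a l => exact foldl_or l a (hl a (by simp)) fun b hb => hl b (by simp [hb])

theorem deriv_not_not_excluded_middle {F : Set Conn} (hd : Conn.disj ∈ F)
    (hn : Conn.nega ∈ F) (φ : PropForm) :
    Deriv F ∅ (.neg (.neg (.or (.neg φ) φ))) := by
  refine .negI (ψ := .neg φ) hn ?_ ?_
  · exact .negI (ψ := .or (.neg φ) φ) hn (.orE2 (φ := .neg φ) hd (.mem (by simp))) (.mem (by simp))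
  · exact .negI (ψ := .or (.neg φ) φ) hn (.orE1 (ψ := φ) hd (.mem (by simp))) (.mem (by simp))

theorem inFrag_not_not_or {F : Set Conn} (hd : Conn.disj ∈ F) (hn : Conn.nega ∈ F) (i j : ℕ) :
    InFrag F (.neg (.neg (.or (.neg (.var i)) (.var j)))) := by
  simp [InFrag, PropForm.conns, Set.insert_subset_iff, hd, hn]

theorem mem_pairs {n i j : ℕ} : (i, j) ∈ pairs n ↔ 1 ≤ i ∧ i < j ∧ j ≤ n + 1 := by
  simp only [pairs, List.mem_flatMap, List.mem_map, List.mem_range'_1, Prod.mk.injEq]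
  constructor
  · rintro ⟨b, hb, a, ha, rfl, rfl⟩
    omega
  · intro h
    exact ⟨j, by omega, i, by omega, rfl, rfl⟩

theorem not_deriv_alphaOrNeg (F : Set Conn) (n : ℕ) : ¬ Deriv F ∅ (alphaOrNeg n) := by
  intro h
  obtain ⟨a, ha, hf⟩ := exists_rootForces_of_bigOrF (h.rootForces (by simp))
  obtain ⟨⟨i, j⟩, hij, rfl⟩ := List.mem_map.1 ha
  have := (mem_pairs.1 hij).2.1
  have := hf.leafForces i
  simp only [LeafForces] at this
  omega

/-- no fragment containing both `∨` and `¬` has a finite semantics. -/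
theorem no_finite_semantics_disj_neg (F : Set Conn)
    (hd : Conn.disj ∈ F) (hn : Conn.nega ∈ F) :
    ¬ HasFiniteSemantics F := by
  rintro ⟨V, _, A, D, H⟩
  set n := Fintype.card V
  have hα : InFrag F (alphaOrNeg n) := by
    refine inFrag_bigOrF hd fun a ha => ?_
    obtain ⟨p, -, rfl⟩ := List.mem_map.1 ha
    exact inFrag_not_not_or hd hn p.1 p.2
  refine not_deriv_alphaOrNeg F n ((H ∅ _ (by simp) hα).2 fun v _ => ?_)
  obtain ⟨i, j, hij, hv⟩ : ∃ i j : Fin (n + 1), i < j ∧ v (i + 1) = v (j + 1) := by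
    obtain ⟨i, j, hne, hv⟩ := Fintype.exists_ne_map_eq_of_card_lt
      (fun k : Fin (n + 1) => v (k + 1)) (by simp [n])
    rcases hne.lt_or_gt with h | h
    exacts [⟨i, j, h, hv⟩, ⟨j, i, h, hv.symm⟩]
  have hd_mem := List.mem_map_of_mem
    (f := fun p : ℕ × ℕ => PropForm.neg (.neg (.or (.neg (.var p.1)) (.var p.2))))
    (mem_pairs.2 ⟨by omega, by omega, by omega⟩ : ((i : ℕ) + 1, (j : ℕ) + 1) ∈ pairs n)
  have hfrag := inFrag_not_not_or hd hn (i + 1) (j + 1)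
  refine (H {_} _ (by simpa using hfrag) hα).1 (deriv_bigOrF_of_mem hd hd_mem) v ?_
  have hem := (H ∅ _ (by simp) (inFrag_not_not_or hd hn (i + 1) (i + 1))).1
    (deriv_not_not_excluded_middle hd hn _) v (by simp)
  simpa [Alg.eval, hv] using hem
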